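/- arXiv:2212.13549 — 2 statements merged into one kernel-verified Lean document; each statement's English description precedes it below -/
import Mathlib

section
/- Let X be a Banach space with weak normal structure and let M be a nonempty convex weakly compact subset of X. Then every commuting family (T_i)_{i∈I} of orbit-nonexpansive self-maps of M has a common fixed point. -/
open Metric Set

/-- The orbit of `x` under `T`: `{x} ∪ {Tⁿ x : n ≥ 1}`. -/
def orbitOf {M : Type*} (T : M → M) (x : M) : Set M :=
  Set.range fun n : ℕ => T^[n] x

/-- `D(x,A) = sup { d(x,a) : a ∈ A }`. -/
noncomputable def Dsup {M : Type*} [MetricSpace M] (x : M) (A : Set M) : ℝ :=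
  sSup (dist x '' A)

/-- A self-map `T` is orbit-nonexpansive if `d(Tx,Ty) ≤ D(x, o_T(y))` for all `x,y`. -/
def OrbitNonexpansive {M : Type*} [MetricSpace M] (T : M → M) : Prop :=
  ∀ x y : M, dist (T x) (T y) ≤ Dsup x (orbitOf T y)

/-- A set is admissible if it is an intersection of closed balls. -/
def Admissible {M : Type*} [MetricSpace M] (A : Set M) : Prop :=
  ∃ C : Set (M × ℝ), A = ⋂ p ∈ C, Metric.closedBall p.1 p.2

/-- The family of admissible sets is compact: any collection of admissible sets whose
finite subcollections have nonempty intersection has nonempty intersection. -/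
def AdmissibleCompact (M : Type*) [MetricSpace M] : Prop :=
  ∀ 𝒞 : Set (Set M), (∀ A ∈ 𝒞, Admissible A) →
    (∀ 𝒟 ⊆ 𝒞, 𝒟.Finite → (⋂₀ 𝒟).Nonempty) → (⋂₀ 𝒞).Nonempty

/-- Metric normal structure: every admissible set with more than one point contains a
point `z` with `D(z,A) < δ(A)`. -/
def MetricNormalStructure (M : Type*) [MetricSpace M] : Prop :=
  ∀ A : Set M, Admissible A → A.Nontrivial → ∃ z ∈ A, Dsup z A < Metric.diam A

/-- `D` is a one-local retract of `M`: any family of closed balls centered in `D` with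
nonempty intersection meets `D`. -/
def OneLocalRetract {M : Type*} [MetricSpace M] (D : Set M) : Prop :=
  ∀ C : Set (M × ℝ), (∀ p ∈ C, p.1 ∈ D) →
    (⋂ p ∈ C, Metric.closedBall p.1 p.2).Nonempty →
    ((⋂ p ∈ C, Metric.closedBall p.1 p.2) ∩ D).Nonempty

/-- A family `F` of self-maps is interlaced orbit-nonexpansive if
`d(Tx,Sy) ≤ sup { D(x, o_R(y)) : R ∈ F }` for all `T,S ∈ F` and `x,y ∈ M`. -/
def InterlacedFamily {M : Type*} [MetricSpace M] (F : Set (M → M)) : Prop :=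
  ∀ T ∈ F, ∀ S ∈ F, ∀ x y : M,
    dist (T x) (S y) ≤ sSup ((fun R => Dsup x (orbitOf R y)) '' F)

/-- `B[A,r] = ⋂_{x ∈ A} B̄(x,r)`. -/
def Bball {M : Type*} [MetricSpace M] (A : Set M) (r : ℝ) : Set M :=
  ⋂ x ∈ A, Metric.closedBall x r

/-- A subset of a normed space is weakly compact if its image in `WeakSpace ℝ X`
(i.e. `X` with the weak topology) is compact. -/
def WeaklyCompactSet {X : Type*} [NormedAddCommGroup X] [NormedSpace ℝ X] (C : Set X) : Prop :=
  IsCompact ((toWeakSpace ℝ X) '' C)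

/-- `X` has weak normal structure. -/
def WeakNormalStructure (X : Type*) [NormedAddCommGroup X] [NormedSpace ℝ X] : Prop :=
  ∀ C : Set X, Convex ℝ C → WeaklyCompactSet C → C.Nontrivial →
    ∃ z ∈ C, Dsup z C < Metric.diam C

section MetricSpaces

variable {M : Type*} [MetricSpace M]

theorem dist_le_Dsup [BoundedSpace M] (x : M) {A : Set M} {a : M} (ha : a ∈ A) :
    dist x a ≤ Dsup x A := by
  refine le_csSup ⟨diam (univ : Set M), ?_⟩ ⟨a, ha, rfl⟩
  rintro _ ⟨b, -, rfl⟩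
  exact dist_le_diam_of_mem (Bornology.IsBounded.all _) (mem_univ x) (mem_univ b)

theorem Dsup_le {x : M} {A : Set M} (hA : A.Nonempty) {r : ℝ} (h : ∀ a ∈ A, dist x a ≤ r) :
    Dsup x A ≤ r := by
  refine csSup_le (hA.image _) ?_
  rintro _ ⟨a, ha, rfl⟩
  exact h a ha

theorem OneLocalRetract.exists_mem {D : Set M} (hD : OneLocalRetract D) {C : Set (M × ℝ)}
    (hC : ∀ p ∈ C, p.1 ∈ D) {x : M} (hx : ∀ p ∈ C, dist x p.1 ≤ p.2) :
    ∃ z ∈ D, ∀ p ∈ C, dist z p.1 ≤ p.2 := by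
  obtain ⟨z, hz, hzD⟩ := hD C hC ⟨x, mem_iInter₂.2 hx⟩
  exact ⟨z, hzD, mem_iInter₂.1 hz⟩

theorem AdmissibleCompact.exists_mem_of_isChain (hM : AdmissibleCompact M) {D : Set M}
    (hD : OneLocalRetract D) {c : Set (Set (M × ℝ))} (hc : IsChain (· ⊆ ·) c)
    (hne : c.Nonempty) (hcD : ∀ C ∈ c, ∀ p ∈ C, p.1 ∈ D)
    (hx : ∀ C ∈ c, ∃ x, ∀ p ∈ C, dist x p.1 ≤ p.2) :
    ∃ z ∈ D, ∀ C ∈ c, ∀ p ∈ C, dist z p.1 ≤ p.2 := by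
  obtain ⟨x, hx⟩ : (⋂₀ ((fun p : M × ℝ => closedBall p.1 p.2) '' ⋃₀ c)).Nonempty := by
    refine hM _ ?_ ?_
    · rintro _ ⟨p, -, rfl⟩
      exact ⟨{p}, by simp⟩
    · intro 𝒟 h𝒟 hfin
      obtain ⟨F, hF, hFfin, rfl⟩ := exists_subset_image_finite_and.1 ⟨𝒟, h𝒟, hfin, rfl⟩
      obtain ⟨C, hC, hFC⟩ :=
        hc.directedOn.exists_mem_subset_of_finite_of_subset_sUnion hne hFfin hF
      obtain ⟨x, hx⟩ := hx C hC
      refine ⟨x, ?_⟩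
      rintro _ ⟨p, hp, rfl⟩
      exact hx p (hFC hp)
  obtain ⟨z, hzD, hz⟩ := hD.exists_mem (C := ⋃₀ c) (x := x)
    (by rintro p ⟨C, hC, hp⟩; exact hcD C hC p hp) fun p hp => hx _ ⟨p, hp, rfl⟩
  exact ⟨z, hzD, fun C hC p hp => hz p ⟨C, hC, hp⟩⟩

theorem MetricNormalStructure.exists_dist_le_lt_diam [BoundedSpace M]
    (hM : MetricNormalStructure M) {D : Set M} (hD : OneLocalRetract D) {C : Set (M × ℝ)}
    (hC : ∀ p ∈ C, p.1 ∈ D) {A : Set M} (hA : A = {x ∈ D | ∀ p ∈ C, dist x p.1 ≤ p.2})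
    (hnt : A.Nontrivial) :
    ∃ r < diam A, ∃ z ∈ A, ∀ a ∈ A, dist z a ≤ r := by
  set H : Set M := ⋂ p ∈ {p : M × ℝ | A ⊆ closedBall p.1 p.2}, closedBall p.1 p.2 with hH
  have mem_H {x : M} : x ∈ H ↔ ∀ y r, A ⊆ closedBall y r → dist x y ≤ r := by
    simp [hH, mem_closedBall]
  have hAH : A ⊆ H := fun x hx => mem_H.2 fun y r h => h hx
  have hdiam : diam H ≤ diam A := by
    refine diam_le_of_forall_dist_le diam_nonneg fun x hx y hy => ?_
    refine mem_H.1 hx y _ fun a ha => ?_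
    rw [mem_closedBall, dist_comm]
    exact mem_H.1 hy a _ fun b hb => dist_le_diam_of_mem (Bornology.IsBounded.all _) hb ha
  obtain ⟨w, hw, hlt⟩ := hM H ⟨_, rfl⟩ (hnt.mono hAH)
  obtain ⟨z, hzD, hz⟩ := hD.exists_mem (C := C ∪ {p | p.1 ∈ A ∧ p.2 = Dsup w H}) (x := w)
    (by
      rintro p (hp | ⟨hp, -⟩)
      · exact hC p hp
      · exact (hA ▸ hp : p.1 ∈ {x ∈ D | ∀ p ∈ C, dist x p.1 ≤ p.2}).1)
    (by
      rintro p (hp | ⟨hp, hr⟩)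
      · refine mem_H.1 hw _ _ fun a ha => ?_
        rw [hA] at ha
        exact ha.2 p hp
      · rw [hr]
        exact dist_le_Dsup w (hAH hp))
  refine ⟨Dsup w H, hlt.trans_le hdiam, z, ?_, fun a ha => hz (a, _) (Or.inr ⟨ha, rfl⟩)⟩
  rw [hA]
  exact ⟨hzD, fun p hp => hz p (Or.inl hp)⟩

theorem OrbitNonexpansive.dist_le {T : M → M} (hT : OrbitNonexpansive T)
    {x y : M} {r : ℝ}
    (h : ∀ n, dist x (T^[n] y) ≤ r) : dist (T x) (T y) ≤ r :=
  (hT x y).trans <| Dsup_le (range_nonempty _) <| by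
    rintro _ ⟨n, rfl⟩
    exact h n

theorem OrbitNonexpansive.oneLocalRetract_inter_fixedPoints [BoundedSpace M]
    (hM : AdmissibleCompact M) (hM' : MetricNormalStructure M) {T : M → M}
    (hT : OrbitNonexpansive T) {D : Set M} (hD : OneLocalRetract D) (hTD : MapsTo T D D) :
    OneLocalRetract {x ∈ D | T x = x} := by
  intro C₀ hC₀ ⟨x₀, hx₀⟩
  rw [mem_iInter₂] at hx₀
  let A (C : Set (M × ℝ)) : Set M := {x ∈ D | ∀ p ∈ C, dist x p.1 ≤ p.2}
  let S : Set (Set (M × ℝ)) :=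
    {C | (∀ p ∈ C, p.1 ∈ D) ∧ (A C).Nonempty ∧ MapsTo T (A C) (A C)}
  have hS₀ : C₀ ∈ S := by
    refine ⟨fun p hp => (hC₀ p hp).1, hD.exists_mem (fun p hp => (hC₀ p hp).1) hx₀, ?_⟩
    intro x hx
    refine ⟨hTD hx.1, fun p hp => ?_⟩
    have := hT.dist_le (x := x) (y := p.1) (r := p.2) fun n => by
      rw [Function.iterate_fixed (hC₀ p hp).2]
      exact hx.2 p hp
    rwa [(hC₀ p hp).2] at this
  obtain ⟨C, hC₀C, hC⟩ := zorn_subset_nonempty S (by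
    intro c hcS hc hne
    refine ⟨⋃₀ c, ⟨?_, ?_, ?_⟩, fun s hs => subset_sUnion_of_mem hs⟩
    · rintro p ⟨C, hC, hp⟩
      exact (hcS hC).1 p hp
    · obtain ⟨z, hzD, hz⟩ := hM.exists_mem_of_isChain hD hc hne (fun C hC => (hcS hC).1)
        fun C hC => let ⟨x, hx⟩ := (hcS hC).2.1; ⟨x, hx.2⟩
      exact ⟨z, hzD, fun p ⟨C, hC, hp⟩ => hz C hC p hp⟩
    · intro x hx
      refine ⟨hTD hx.1, fun p ⟨C, hC, hp⟩ => ?_⟩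
      exact ((hcS hC).2.2 ⟨hx.1, fun q hq => hx.2 q ⟨C, hC, hq⟩⟩).2 p hp) C₀ hS₀
  obtain ⟨hCD, ⟨x, hx⟩, hCT⟩ := hC.prop
  have hmax {C' : Set (M × ℝ)} (h : C ∪ C' ∈ S) : C' ⊆ C :=
    subset_union_right.trans (hC.le_of_ge h subset_union_left)
  have hA_union {C' : Set (M × ℝ)} {x : M} (hx : x ∈ A C) (h : ∀ p ∈ C', dist x p.1 ≤ p.2) :
      x ∈ A (C ∪ C') := ⟨hx.1, fun p hp => hp.elim (hx.2 p) (h p)⟩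
  have hA_anti {C' : Set (M × ℝ)} : A (C ∪ C') ⊆ A C :=
    fun x hx => ⟨hx.1, fun p hp => hx.2 p (Or.inl hp)⟩
  have hull {y : M} {r : ℝ} (hy : y ∈ D) (h : ∀ a ∈ A C, dist (T a) y ≤ r) :
      ∀ a ∈ A C, dist a y ≤ r := by
    have key : ∀ a ∈ A C, T a ∈ A (C ∪ {(y, r)}) := fun a ha =>
      hA_union (hCT ha) (by rintro p rfl; exact h a ha)
    have := hmax (C' := {(y, r)}) ⟨?_, ⟨T x, key x hx⟩, fun a ha => key a (hA_anti ha)⟩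
    · exact fun a ha => ha.2 (y, r) (this rfl)
    · rintro p (hp | rfl)
      · exact hCD p hp
      · exact hy
  have hsub : (A C).Subsingleton := by
    by_contra hnt
    rw [not_subsingleton_iff] at hnt
    obtain ⟨r, hr, z, hz, hzr⟩ := hM'.exists_dist_le_lt_diam hD hCD (A := A C) rfl hnt
    have hsubC : {p : M × ℝ | p.1 ∈ A C ∧ p.2 = r} ⊆ C := by
      refine hmax ⟨?_, ⟨z, hA_union hz ?_⟩, ?_⟩
      · rintro p (hp | ⟨hp, -⟩)
        · exact hCD p hp
        · exact hp.1
      · rintro p ⟨hp, hr⟩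
        exact (hzr _ hp).trans hr.ge
      · intro y hy
        refine hA_union (hCT (hA_anti hy)) ?_
        rintro ⟨a, _⟩ ⟨ha, rfl⟩
        rw [dist_comm]
        refine hull (hTD hy.1) (fun b hb => ?_) a ha
        rw [dist_comm]
        refine hT.dist_le fun n => ?_
        exact hy.2 (T^[n] b, _) (Or.inr ⟨hCT.iterate n hb, rfl⟩)
    refine hr.not_ge (diam_le_of_forall_dist_le_of_nonempty hnt.nonempty fun a ha b hb => ?_)
    exact ha.2 (b, r) (hsubC ⟨hb, rfl⟩)
  exact ⟨x, mem_iInter₂.2 fun p hp => hx.2 p (hC₀C hp), hx.1, hsub (hCT hx) hx⟩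

theorem AdmissibleCompact.oneLocalRetract_sInter [BoundedSpace M]
    (hM : AdmissibleCompact M) (hM' : MetricNormalStructure M) {𝒟 : Set (Set M)}
    (hchain : IsChain (· ⊆ ·) 𝒟) (hne : 𝒟.Nonempty) (h𝒟 : ∀ D ∈ 𝒟, OneLocalRetract D) :
    OneLocalRetract (⋂₀ 𝒟) := by
  intro B hB ⟨x₀, hx₀⟩
  rw [mem_iInter₂] at hx₀
  let A (C : Set (Set M × M × ℝ)) (D : Set M) : Set M :=
    {x ∈ D | ∀ p ∈ {p | (D, p) ∈ C}, dist x p.1 ≤ p.2}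
  let S : Set (Set (Set M × M × ℝ)) :=
    {C | (∀ D, ∀ p ∈ {p | (D, p) ∈ C}, p.1 ∈ D) ∧ (∀ D ∈ 𝒟, (A C D).Nonempty) ∧
      ∀ D ∈ 𝒟, ∀ E ∈ 𝒟, D ⊆ E → A C D ⊆ A C E}
  let C₀ : Set (Set M × M × ℝ) := {q | q.1 ∈ 𝒟 ∧ q.2 ∈ B}
  have hS₀ : C₀ ∈ S := by
    refine ⟨fun D p hp => hB p hp.2 D hp.1, fun D hD => ?_, fun D hD E hE hDE x hx => ?_⟩
    · exact (h𝒟 D hD).exists_mem (fun p hp => hB p hp.2 D hp.1) (x := x₀) fun p hp => hx₀ p hp.2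
    · exact ⟨hDE hx.1, fun p hp => hx.2 p ⟨hD, hp.2⟩⟩
  obtain ⟨C, hC₀C, hC⟩ := zorn_subset_nonempty S (by
    intro c hcS hc hcne
    refine ⟨⋃₀ c, ⟨?_, fun D hD => ?_, ?_⟩, fun s hs => subset_sUnion_of_mem hs⟩
    · rintro D p ⟨C, hC, hp⟩
      exact (hcS hC).1 D p hp
    · obtain ⟨z, hzD, hz⟩ := hM.exists_mem_of_isChain (h𝒟 D hD)
        (c := (fun C => {p | (D, p) ∈ C}) '' c)
        (by
          rintro _ ⟨C, hC, rfl⟩ _ ⟨C', hC', rfl⟩ -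
          exact (hc.total hC hC').imp (fun h p hp => h hp) fun h p hp => h hp)
        (hcne.image _)
        (by rintro _ ⟨C, hC, rfl⟩; exact (hcS hC).1 D)
        (by
          rintro _ ⟨C, hC, rfl⟩
          obtain ⟨x, hx⟩ := (hcS hC).2.1 D hD
          exact ⟨x, hx.2⟩)
      exact ⟨z, hzD, fun p ⟨C, hC, hp⟩ => hz _ ⟨C, hC, rfl⟩ p hp⟩
    · intro D hD E hE hDE x hx
      refine ⟨hDE hx.1, fun p ⟨C, hC, hp⟩ => ?_⟩
      exact ((hcS hC).2.2 D hD E hE hDE ⟨hx.1, fun q hq => hx.2 q ⟨C, hC, hq⟩⟩).2 p hp) C₀ hS₀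
  obtain ⟨hCD, hCne, hCmono⟩ := hC.prop
  have hmax {C' : Set (Set M × M × ℝ)} (h : C ∪ C' ∈ S) : C' ⊆ C :=
    subset_union_right.trans (hC.le_of_ge h subset_union_left)
  have hA_union {C' : Set (Set M × M × ℝ)} {D : Set M} {x : M} (hx : x ∈ A C D)
      (h : ∀ p, (D, p) ∈ C' → dist x p.1 ≤ p.2) : x ∈ A (C ∪ C') D :=
    ⟨hx.1, fun p hp => hp.elim (hx.2 p) (h p)⟩
  have hA_anti {C' : Set (Set M × M × ℝ)} {D : Set M} : A (C ∪ C') D ⊆ A C D :=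
    fun x hx => ⟨hx.1, fun p hp => hx.2 p (Or.inl hp)⟩
  have hull {D E : Set M} (hD : D ∈ 𝒟) (hE : E ∈ 𝒟) (hDE : D ⊆ E) {y : M} {r : ℝ} (hy : y ∈ D)
      (h : ∀ a ∈ A C D, dist a y ≤ r) : ∀ a ∈ A C E, dist a y ≤ r := by
    have := hmax (C' := {q | q.1 ∈ 𝒟 ∧ D ⊆ q.1 ∧ q.2 = (y, r)}) ⟨?_, ?_, ?_⟩
    · exact fun a ha => ha.2 (y, r) (this ⟨hE, hDE, rfl⟩)
    · rintro F p (hp | ⟨-, hDF, rfl⟩)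
      · exact hCD F p hp
      · exact hDF hy
    · intro F hF
      rcases hchain.total hD hF with hDF | hFD
      · obtain ⟨a, ha⟩ := hCne D hD
        refine ⟨a, hA_union (hCmono D hD F hF hDF ha) ?_⟩
        rintro p ⟨-, -, rfl⟩
        exact h a ha
      · obtain ⟨a, ha⟩ := hCne F hF
        refine ⟨a, hA_union ha ?_⟩
        rintro p ⟨-, -, rfl⟩
        exact h a (hCmono F hF D hD hFD ha)
    · intro F hF G hG hFG a ha
      refine hA_union (hCmono F hF G hG hFG (hA_anti ha)) ?_
      rintro p ⟨-, -, rfl⟩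
      rcases hchain.total hD hF with hDF | hFD
      · exact ha.2 (y, r) (Or.inr ⟨hF, hDF, rfl⟩)
      · exact h a (hCmono F hF D hD hFD (hA_anti ha))
  have hsub : ∀ D ∈ 𝒟, (A C D).Subsingleton := by
    intro D hD
    by_contra hnt
    rw [not_subsingleton_iff] at hnt
    obtain ⟨r, hr, z, hz, hzr⟩ := hM'.exists_dist_le_lt_diam (h𝒟 D hD) (hCD D) (A := A C D) rfl hnt
    have hsubC : {q : Set M × M × ℝ | q.2.1 ∈ A C q.1 ∧ q.2.2 = r} ⊆ C := by
      refine hmax ⟨?_, fun E hE => ?_, fun E hE F hF hEF x hx => ?_⟩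
      · rintro F p (hp | ⟨hp, -⟩)
        · exact hCD F p hp
        · exact hp.1
      · rcases hchain.total hD hE with hDE | hED
        · refine ⟨z, hA_union (hCmono D hD E hE hDE hz) ?_⟩
          rintro ⟨a, _⟩ ⟨ha, rfl⟩
          rw [dist_comm]
          exact hull hD hE hDE hz.1 (fun b hb => (dist_comm _ _).trans_le (hzr b hb)) a ha
        · obtain ⟨w, hwE, hw⟩ := (h𝒟 E hE).exists_mem (x := z)
            (C := {p | (E, p) ∈ C} ∪ {p | p.1 ∈ A C E ∧ p.2 = r})
            (by
              rintro p (hp | ⟨hp, -⟩)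
              · exact hCD E p hp
              · exact hp.1)
            (by
              rintro p (hp | ⟨hp, hpr⟩)
              · exact hull hE hD hED (hCD E p hp) (fun a ha => ha.2 p hp) z hz
              · exact (hzr _ (hCmono E hE D hD hED hp)).trans hpr.ge)
          refine ⟨w, hA_union ⟨hwE, fun p hp => hw p (Or.inl hp)⟩ ?_⟩
          exact fun p hp => hw p (Or.inr hp)
      · refine hA_union (hCmono E hE F hF hEF (hA_anti hx)) ?_
        rintro ⟨a, _⟩ ⟨ha, rfl⟩
        rw [dist_comm]
        refine hull hE hF hEF hx.1 (fun b hb => ?_) a ha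
        rw [dist_comm]
        exact hx.2 (b, _) (Or.inr ⟨hb, rfl⟩)
    refine hr.not_ge (diam_le_of_forall_dist_le_of_nonempty hnt.nonempty fun a ha b hb => ?_)
    exact ha.2 (b, r) (hsubC ⟨hb, rfl⟩)
  obtain ⟨D, hD⟩ := hne
  obtain ⟨x, hx⟩ := hCne D hD
  refine ⟨x, mem_iInter₂.2 fun p hp => hx.2 p (hC₀C ⟨hD, hp⟩), fun E hE => ?_⟩
  rcases hchain.total hD hE with hDE | hED
  · exact hDE hx.1
  · obtain ⟨y, hy⟩ := hCne E hE
    rw [hsub D hD hx (hCmono E hE D hD hED hy)]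
    exact hy.1

theorem exists_common_fixedPoint_of_metricNormalStructure [BoundedSpace M] [Nonempty M]
    (hM : AdmissibleCompact M) (hM' : MetricNormalStructure M) {I : Type*} (T : I → M → M)
    (hcomm : ∀ i j : I, T i ∘ T j = T j ∘ T i) (hT : ∀ i : I, OrbitNonexpansive (T i)) :
    ∃ x : M, ∀ i : I, T i x = x := by
  let F (J : Set I) : Set M := {x | ∀ i ∈ J, T i x = x}
  have hempty : OneLocalRetract (F ∅) := fun C _ ⟨x, hx⟩ => ⟨x, hx, by simp [F]⟩
  obtain ⟨J, -, hJ⟩ := zorn_subset_nonempty {J | OneLocalRetract (F J)} (by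
    intro c hcS hc hne
    refine ⟨⋃₀ c, ?_, fun s hs => subset_sUnion_of_mem hs⟩
    have hF : F (⋃₀ c) = ⋂₀ (F '' c) := by
      ext x
      simp only [F, sInter_image, mem_iInter, mem_ofPred_eq, mem_sUnion]
      exact ⟨fun h J hJ i hi => h i ⟨J, hJ, hi⟩, fun h i ⟨J, hJ, hi⟩ => h J hJ i hi⟩
    rw [mem_ofPred_eq, hF]
    refine hM.oneLocalRetract_sInter hM' ?_ (hne.image _) ?_
    · rintro _ ⟨J, hJ, rfl⟩ _ ⟨K, hK, rfl⟩ -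
      rcases hc.total hJ hK with h | h
      · exact Or.inr fun x hx i hi => hx i (h hi)
      · exact Or.inl fun x hx i hi => hx i (h hi)
    · rintro _ ⟨J, hJ, rfl⟩
      exact hcS hJ) ∅ hempty
  have hmem (i : I) : i ∈ J := by
    refine hJ.le_of_ge (y := insert i J) ?_ (subset_insert i J) (mem_insert i J)
    have hF : F (insert i J) = {x ∈ F J | T i x = x} := by
      ext x
      simp [F, and_comm]
    rw [mem_ofPred_eq, hF]
    refine (hT i).oneLocalRetract_inter_fixedPoints hM hM' hJ.prop fun x hx j hj => ?_
    rw [← Function.comp_apply (f := T j), hcomm, Function.comp_apply, hx j hj]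
  obtain ⟨x, -, hx⟩ := hJ.prop ∅ (by simp) (by simp)
  exact ⟨x, fun i => hx i (hmem i)⟩

end MetricSpaces

theorem Dsup_coe {X : Type*} [MetricSpace X] {M : Set X} (x : M) (A : Set M) :
    Dsup (x : X) ((↑) '' A) = Dsup x A := by
  simp [Dsup, image_image, Subtype.dist_eq]

section WeaklyCompact

variable {X : Type*} [NormedAddCommGroup X] [NormedSpace ℝ X]

theorem Convex.isClosed_image_toWeakSpace {s : Set X} (hs : Convex ℝ s) (hs' : IsClosed s) :
    IsClosed (toWeakSpace ℝ X '' s) := by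
  rw [← closure_eq_iff_isClosed, ← hs.toWeakSpace_closure ℝ, hs'.closure_eq]

theorem WeaklyCompactSet.isBounded {s : Set X} (hs : WeaklyCompactSet s) :
    Bornology.IsBounded s := by
  obtain ⟨C, hC⟩ := banach_steinhaus
    (g := fun x : s => NormedSpace.inclusionInDoubleDual ℝ X x) fun f => by
      have hf : Continuous fun x : WeakSpace ℝ X => ‖f ((toWeakSpace ℝ X).symm x)‖ :=
        (WeakBilin.eval_continuous (topDualPairing ℝ X).flip f).norm
      obtain ⟨C, hC⟩ := (hs.image hf).bddAbove
      exact ⟨C, fun x => hC ⟨_, mem_image_of_mem _ x.2, by simp⟩⟩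
  refine isBounded_iff_forall_norm_le.2 ⟨C, fun x hx => ?_⟩
  have := hC ⟨x, hx⟩
  rwa [← (NormedSpace.inclusionInDoubleDualLi (𝕜 := ℝ) (E := X)).norm_map x]

theorem Admissible.exists_image_eq {M : Set X} {A : Set M} (hA : Admissible A) :
    ∃ K : Set X, Convex ℝ K ∧ IsClosed K ∧ (↑) '' A = M ∩ K := by
  obtain ⟨C, rfl⟩ := hA
  refine ⟨⋂ p ∈ C, closedBall (p.1 : X) p.2, convex_iInter₂ fun p _ => convex_closedBall _ _,
    isClosed_biInter fun p _ => isClosed_closedBall, ?_⟩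
  ext x
  simp [Subtype.dist_eq, and_comm]

theorem WeaklyCompactSet.inter {M K : Set X} (hM : WeaklyCompactSet M) (hK : Convex ℝ K)
    (hK' : IsClosed K) : WeaklyCompactSet (M ∩ K) := by
  rw [WeaklyCompactSet, image_inter (toWeakSpace ℝ X).injective]
  exact IsCompact.inter_right hM (hK.isClosed_image_toWeakSpace hK')

theorem WeaklyCompactSet.admissibleCompact {M : Set X} (hM : WeaklyCompactSet M) :
    AdmissibleCompact M := by
  intro 𝒞 h𝒞 hfin
  choose! K hK hK' hKM using fun A hA => (h𝒞 A hA).exists_image_eq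
  have hmem {A : Set M} (hA : A ∈ 𝒞) (x : M) : x ∈ A ↔ (x : X) ∈ K A := by
    have := Set.ext_iff.1 (hKM A hA) x
    simpa using this
  obtain ⟨_, ⟨x, hx, rfl⟩, hxK⟩ := hM.inter_iInter_nonempty
    (fun A : 𝒞 => toWeakSpace ℝ X '' K A)
    (fun A => (hK A A.2).isClosed_image_toWeakSpace (hK' A A.2)) fun u => by
      obtain ⟨x, hx⟩ := hfin ((↑) '' (u : Set 𝒞)) (by simp) (u.finite_toSet.image _)
      refine ⟨_, mem_image_of_mem _ x.2, mem_iInter₂.2 fun A hA => mem_image_of_mem _ ?_⟩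
      exact (hmem A.2 x).1 (hx A ⟨A, hA, rfl⟩)
  refine ⟨⟨x, hx⟩, fun A hA => (hmem hA _).2 ?_⟩
  obtain ⟨y, hy, hyx⟩ := mem_iInter.1 hxK ⟨A, hA⟩
  exact (toWeakSpace ℝ X).injective hyx ▸ hy

theorem WeakNormalStructure.metricNormalStructure (hX : WeakNormalStructure X) {M : Set X}
    (hM : Convex ℝ M) (hM' : WeaklyCompactSet M) : MetricNormalStructure M := by
  intro A hA hnt
  obtain ⟨K, hK, hK', hAK⟩ := hA.exists_image_eq
  obtain ⟨_, ⟨z, hz, rfl⟩, hlt⟩ := hX ((↑) '' A) (hAK ▸ hM.inter hK)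
    (hAK ▸ hM'.inter hK hK') (hnt.image Subtype.val_injective)
  rw [Dsup_coe, isometry_subtype_coe.diam_image] at hlt
  exact ⟨z, hz, hlt⟩

end WeaklyCompact

theorem stmt5 {X : Type*} [NormedAddCommGroup X] [NormedSpace ℝ X] [CompleteSpace X]
    (hwns : WeakNormalStructure X)
    (M : Set X) (hne : M.Nonempty) (hconv : Convex ℝ M) (hcomp : WeaklyCompactSet M)
    {I : Type*} (T : I → M → M)
    (hcomm : ∀ i j : I, T i ∘ T j = T j ∘ T i)
    (hone : ∀ i : I, OrbitNonexpansive (T i)) :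
    ∃ x : M, ∀ i : I, T i x = x := by
  have := hne.to_subtype
  have := boundedSpace_val_set_iff.2 hcomp.isBounded
  exact exists_common_fixedPoint_of_metricNormalStructure hcomp.admissibleCompact
    (hwns.metricNormalStructure hconv hcomp) T hcomm hone
end

section
/- Let (M,d) be a bounded metric space with (p,q)-uniform relative normal structure for some p > 0 and q ∈ (0,1), such that the family A(M) of admissible subsets is compact, and let F be a family of interlaced orbit-nonexpansive self-maps of M. Then there exists a common fixed point for all mappings in F. -/
open Metric Set

theorem Admissible.sInter {M : Type*} [MetricSpace M] {𝒞 : Set (Set M)}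
    (h : ∀ A ∈ 𝒞, Admissible A) : Admissible (⋂₀ 𝒞) := by
  refine ⟨{p | ⋂₀ 𝒞 ⊆ closedBall p.1 p.2}, Subset.antisymm ?_ ?_⟩
  · exact subset_iInter₂ fun p hp => hp
  · intro x hx A hA
    obtain ⟨C, rfl⟩ := h A hA
    simp only [mem_iInter] at hx ⊢
    intro p hp
    exact hx p ((sInter_subset_of_mem hA).trans (biInter_subset_of_mem hp))

theorem Admissible.inter {M : Type*} [MetricSpace M] {A B : Set M}
    (hA : Admissible A) (hB : Admissible B) : Admissible (A ∩ B) := by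
  rw [← sInter_pair]
  refine Admissible.sInter ?_
  rintro C (rfl | rfl)
  exacts [hA, hB]

theorem admissible_closedBall {M : Type*} [MetricSpace M] (x : M) (r : ℝ) :
    Admissible (closedBall x r) :=
  ⟨{(x, r)}, by simp⟩

theorem admissible_univ (M : Type*) [MetricSpace M] : Admissible (univ : Set M) :=
  ⟨∅, by simp⟩

theorem mem_Bball {M : Type*} [MetricSpace M] {A : Set M} {r : ℝ} {x : M} :
    x ∈ Bball A r ↔ ∀ a ∈ A, dist x a ≤ r := by
  simp [Bball]

theorem admissible_Bball {M : Type*} [MetricSpace M] (A : Set M) (r : ℝ) :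
    Admissible (Bball A r) := by
  rw [Bball, ← sInter_image]
  refine Admissible.sInter ?_
  rintro _ ⟨x, -, rfl⟩
  exact admissible_closedBall x r

/-- The nonempty admissible sets invariant under every member of `F`. -/
def invariantAdmissible {M : Type*} [MetricSpace M] (F : Set (M → M)) : Set (Set M) :=
  {A | Admissible A ∧ A.Nonempty ∧ ∀ T ∈ F, MapsTo T A A}

theorem InterlacedFamily.dist_le {M : Type*} [MetricSpace M] {F : Set (M → M)}
    (hF : InterlacedFamily F) {A : Set M} (hA : ∀ T ∈ F, MapsTo T A A) {x : M} {r : ℝ}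
    (hx : ∀ a ∈ A, dist x a ≤ r) {T S : M → M} (hT : T ∈ F) (hS : S ∈ F) {y : M}
    (hy : y ∈ A) : dist (T x) (S y) ≤ r := by
  have hr : 0 ≤ r := dist_nonneg.trans (hx y hy)
  refine (hF T hT S hS x y).trans (Real.sSup_le ?_ hr)
  rintro _ ⟨R, hR, rfl⟩
  refine Real.sSup_le ?_ hr
  rintro _ ⟨_, ⟨n, rfl⟩, rfl⟩
  exact hx _ ((hA R hR).iterate n hy)

theorem IsChain.exists_subset_of_finite {α : Type*} {c : Set (Set α)}
    (hc : IsChain (· ⊆ ·) c) (hne : c.Nonempty) {𝒟 : Set (Set α)} (hD : 𝒟.Finite)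
    (hsub : 𝒟 ⊆ c) : ∃ A ∈ c, ∀ B ∈ 𝒟, A ⊆ B := by
  induction 𝒟, hD using Set.Finite.induction_on with
  | empty => exact ⟨hne.some, hne.some_mem, by simp⟩
  | @insert B 𝒟 _ _ ih =>
    obtain ⟨A, hA, hAD⟩ := ih ((subset_insert _ _).trans hsub)
    have hB : B ∈ c := hsub (mem_insert _ _)
    rcases hc.total hA hB with h | h
    · refine ⟨A, hA, ?_⟩
      rintro C (rfl | hC)
      exacts [h, hAD C hC]
    · refine ⟨B, hB, ?_⟩
      rintro C (rfl | hC)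
      exacts [Subset.rfl, h.trans (hAD C hC)]

theorem AdmissibleCompact.exists_minimal {M : Type*} [MetricSpace M]
    (hcompact : AdmissibleCompact M) (F : Set (M → M)) {A : Set M}
    (hA : A ∈ invariantAdmissible F) :
    ∃ B ⊆ A, Minimal (· ∈ invariantAdmissible F) B := by
  refine zorn_superset_nonempty (invariantAdmissible F) ?_ A hA
  intro c hcS hc hne
  refine ⟨⋂₀ c, ⟨Admissible.sInter fun B hB => (hcS hB).1, ?_, ?_⟩,
    fun s hs => sInter_subset_of_mem hs⟩
  · refine hcompact c (fun B hB => (hcS hB).1) fun 𝒟 hDc hD => ?_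
    obtain ⟨B, hB, hBD⟩ := hc.exists_subset_of_finite hne hD hDc
    exact (hcS hB).2.1.mono (subset_sInter hBD)
  · intro T hT x hx B hB
    exact (hcS hB).2.2 T hT (hx B hB)

theorem InterlacedFamily.mapsTo_Bball {M : Type*} [MetricSpace M] {F : Set (M → M)}
    (hF : InterlacedFamily F) {A : Set M} (hA : Minimal (· ∈ invariantAdmissible F) A)
    (r : ℝ) {T : M → M} (hT : T ∈ F) : MapsTo T (Bball A r) (Bball A r) := by
  intro x hx
  rw [mem_Bball] at hx ⊢
  obtain ⟨hAadm, ⟨y, hy⟩, hAinv⟩ := hA.prop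
  have key : ∀ S ∈ F, ∀ w ∈ A, S w ∈ A ∩ closedBall (T x) r := fun S hS w hw =>
    ⟨hAinv S hS hw, by
      rw [mem_closedBall']
      exact hF.dist_le hAinv hx hT hS hw⟩
  have hmem : A ∩ closedBall (T x) r ∈ invariantAdmissible F :=
    ⟨hAadm.inter (admissible_closedBall _ _), ⟨T y, key T hT y hy⟩,
      fun S hS w hw => key S hS w hw.1⟩
  intro a ha
  exact mem_closedBall'.1 (hA.le_of_le hmem inter_subset_left ha).2

/-- A point of an invariant admissible set `B` that is within `r` of all of `B` lies in an
invariant admissible subset of `B` whose points are pairwise within `r`. -/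
theorem InterlacedFamily.exists_invariant_dist_le {M : Type*} [MetricSpace M]
    {F : Set (M → M)} (hF : InterlacedFamily F) {B : Set M}
    (hB : B ∈ invariantAdmissible F) {z : M} (hz : z ∈ B) {r : ℝ} (hzr : z ∈ Bball B r) :
    ∃ K ∈ invariantAdmissible F, K ⊆ B ∧ ∀ x ∈ K, ∀ y ∈ K, dist x y ≤ r := by
  set K : Set M := ⋂₀ {L | L ∈ invariantAdmissible F ∧ z ∈ L} with hK
  have hzK : z ∈ K := fun L hL => hL.2
  have hKmin : ∀ L ∈ invariantAdmissible F, z ∈ L → K ⊆ L := fun L hL hzL =>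
    sInter_subset_of_mem ⟨hL, hzL⟩
  have hKadm : Admissible K := Admissible.sInter fun L hL => hL.1.1
  have hKinv : ∀ T ∈ F, MapsTo T K K := fun T hT x hx L hL => hL.1.2.2 T hT (hx L hL)
  have hKB : K ⊆ B := hKmin B hB hz
  rw [mem_Bball] at hzr
  refine ⟨K, ⟨hKadm, ⟨z, hzK⟩, hKinv⟩, hKB, ?_⟩
  have hzK' : z ∈ K ∩ Bball K r := ⟨hzK, mem_Bball.2 fun a ha => hzr a (hKB ha)⟩
  have hmem : K ∩ Bball K r ∈ invariantAdmissible F := by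
    refine ⟨hKadm.inter (admissible_Bball _ _), ⟨z, hzK'⟩, ?_⟩
    rintro T hT x ⟨hxK, hxr⟩
    rw [mem_Bball] at hxr
    have hTx : T x ∈ K := hKinv T hT hxK
    have hzmem : z ∈ K ∩ closedBall (T x) r :=
      ⟨hzK, mem_closedBall.2 (hzr _ (hKB hTx))⟩
    have hball : K ∩ closedBall (T x) r ∈ invariantAdmissible F :=
      ⟨hKadm.inter (admissible_closedBall _ _), ⟨z, hzmem⟩, fun S hS w hw =>
        ⟨hKinv S hS hw.1, mem_closedBall'.2 (hF.dist_le hKinv hxr hT hS hw.1)⟩⟩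
    exact ⟨hTx, mem_Bball.2 fun a ha => mem_closedBall'.1 (hKmin _ hball hzmem ha).2⟩
  intro x hx y hy
  exact mem_Bball.1 (hKmin _ hmem hzK' hx).2 y hy

theorem InterlacedFamily.exists_smaller_minimal {M : Type*} [MetricSpace M]
    (hM : Bornology.IsBounded (Set.univ : Set M))
    {p q : ℝ} (hq0 : 0 < q)
    (hpq : ∀ A : Set M, Admissible A → 0 < Metric.diam A →
      (Bball A (p * Metric.diam A) ∩
        Bball (Bball A (p * Metric.diam A)) (q * Metric.diam A)).Nonempty)
    (hcompact : AdmissibleCompact M) {F : Set (M → M)} (hF : InterlacedFamily F)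
    {A : Set M} (hA : Minimal (· ∈ invariantAdmissible F) A) :
    ∃ A', Minimal (· ∈ invariantAdmissible F) A' ∧ diam A' ≤ q * diam A ∧
      ∀ a ∈ A, ∀ b ∈ A', dist a b ≤ p * diam A := by
  rcases (diam_nonneg (s := A)).eq_or_lt with h0 | hpos
  · refine ⟨A, hA, by simp [← h0], fun a ha b hb => ?_⟩
    rw [← h0, mul_zero, h0]
    exact dist_le_diam_of_mem (hM.subset (subset_univ _)) ha hb
  · obtain ⟨z, hz, hz'⟩ := hpq A hA.prop.1 hpos
    have hB : Bball A (p * diam A) ∈ invariantAdmissible F :=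
      ⟨admissible_Bball _ _, ⟨z, hz⟩, fun T hT => hF.mapsTo_Bball hA _ hT⟩
    obtain ⟨K, hK, hKB, hKd⟩ := hF.exists_invariant_dist_le hB hz hz'
    obtain ⟨A', hA'K, hA'⟩ := hcompact.exists_minimal F hK
    refine ⟨A', hA', diam_le_of_forall_dist_le (by positivity) fun x hx y hy =>
      hKd x (hA'K hx) y (hA'K hy), fun a ha b hb => ?_⟩
    rw [dist_comm]
    exact mem_Bball.1 (hKB (hA'K hb)) a ha

/-- A sequence with geometrically decaying steps stays, from each index on, in a closed ball
of geometrically decaying radius; compactness of the admissible sets yields a limit. -/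
theorem AdmissibleCompact.exists_dist_le_geometric {M : Type*} [MetricSpace M]
    (hcompact : AdmissibleCompact M) {x : ℕ → M} {c q : ℝ} (hc : 0 ≤ c) (hq0 : 0 < q)
    (hq1 : q < 1) (hx : ∀ n, dist (x n) (x (n + 1)) ≤ c * q ^ n) :
    ∃ y, ∀ n, dist y (x n) ≤ c * q ^ n / (1 - q) := by
  have h1q : 0 < 1 - q := sub_pos.2 hq1
  have hdist : ∀ k n, dist (x (n + k)) (x n) ≤ c * q ^ n / (1 - q) := by
    intro k
    induction k with
    | zero => intro n; rw [add_zero, dist_self]; positivity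
    | succ k ih =>
      intro n
      have h1 := ih (n + 1)
      have h2 := hx n
      have h3 := dist_triangle_right (x (n + (k + 1))) (x n) (x (n + 1))
      have h4 : c * q ^ n + c * q ^ (n + 1) / (1 - q) = c * q ^ n / (1 - q) := by
        field_simp
        ring
      rw [show n + 1 + k = n + (k + 1) by ring] at h1
      linarith
  have hne : (⋂₀ range fun n => closedBall (x n) (c * q ^ n / (1 - q))).Nonempty := by
    refine hcompact _ ?_ ?_
    · rintro _ ⟨n, rfl⟩
      exact admissible_closedBall _ _
    · intro 𝒟 hsub hfin
      have hindex : ∀ D ∈ 𝒟, ∃ n, closedBall (x n) (c * q ^ n / (1 - q)) = D :=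
        fun D hD => hsub hD
      choose! f hf using hindex
      obtain ⟨N, hN⟩ := (hfin.image f).bddAbove
      refine ⟨x N, fun D hD => ?_⟩
      have hle : f D ≤ N := hN (mem_image_of_mem f hD)
      rw [← hf D hD, mem_closedBall]
      simpa [Nat.add_sub_cancel' hle] using hdist (N - f D) (f D)
  obtain ⟨y, hy⟩ := hne
  exact ⟨y, fun n => hy _ ⟨n, rfl⟩⟩

theorem stmt8 {M : Type*} [MetricSpace M] [Nonempty M]
    (hM : Bornology.IsBounded (Set.univ : Set M))
    (p q : ℝ) (hp : 0 < p) (hq0 : 0 < q) (hq1 : q < 1)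
    (hpq : ∀ A : Set M, Admissible A → 0 < Metric.diam A →
      (Bball A (p * Metric.diam A) ∩
        Bball (Bball A (p * Metric.diam A)) (q * Metric.diam A)).Nonempty)
    (hcompact : AdmissibleCompact M)
    (F : Set (M → M)) (hF : InterlacedFamily F) :
    ∃ x : M, ∀ T ∈ F, T x = x := by
  obtain ⟨A₀, -, hA₀⟩ := hcompact.exists_minimal F (A := univ)
    ⟨admissible_univ M, univ_nonempty, fun T _ => mapsTo_univ T _⟩
  choose! next hnext using fun A (hA : Minimal (· ∈ invariantAdmissible F) A) =>
    hF.exists_smaller_minimal hM hq0 hpq hcompact hA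
  set A : ℕ → Set M := fun n => next^[n] A₀ with hAdef
  have hsucc : ∀ n, A (n + 1) = next (A n) := fun n => Function.iterate_succ_apply' next n A₀
  have hmin : ∀ n, Minimal (· ∈ invariantAdmissible F) (A n) := by
    intro n
    induction n with
    | zero => exact hA₀
    | succ n ih => rw [hsucc]; exact (hnext _ ih).1
  set δ := diam A₀ with hδ
  have hδ0 : 0 ≤ δ := diam_nonneg
  have hdiam : ∀ n, diam (A n) ≤ δ * q ^ n := by
    intro n
    induction n with
    | zero => simp [hAdef, hδ]
    | succ n ih =>
      rw [hsucc]
      calc diam (next (A n)) ≤ q * diam (A n) := (hnext _ (hmin n)).2.1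
        _ ≤ q * (δ * q ^ n) := by gcongr
        _ = δ * q ^ (n + 1) := by ring
  choose x hx using fun n => (hmin n).prop.2.1
  have hstep : ∀ n, dist (x n) (x (n + 1)) ≤ p * δ * q ^ n := by
    intro n
    have h := (hnext _ (hmin n)).2.2 (x n) (hx n) (x (n + 1)) (hsucc n ▸ hx (n + 1))
    calc dist (x n) (x (n + 1)) ≤ p * diam (A n) := h
      _ ≤ p * (δ * q ^ n) := by gcongr; exact hdiam n
      _ = p * δ * q ^ n := by ring
  obtain ⟨y, hy⟩ := hcompact.exists_dist_le_geometric (by positivity) hq0 hq1 hstep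
  refine ⟨y, fun T hT => ?_⟩
  have hyA : ∀ n, ∀ a ∈ A n, dist y a ≤ (p * δ / (1 - q) + δ) * q ^ n := by
    intro n a ha
    calc dist y a ≤ dist y (x n) + dist (x n) a := dist_triangle _ _ _
      _ ≤ p * δ * q ^ n / (1 - q) + δ * q ^ n := add_le_add (hy n)
        ((dist_le_diam_of_mem (hM.subset (subset_univ _)) (hx n) ha).trans (hdiam n))
      _ = (p * δ / (1 - q) + δ) * q ^ n := by ring
  have hbound : ∀ n, dist (T y) y ≤ 2 * (p * δ / (1 - q) + δ) * q ^ n := by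
    intro n
    have hinv := (hmin n).prop.2.2
    have h1 := hF.dist_le hinv (hyA n) hT hT (hx n)
    have h2 := hyA n _ (hinv T hT (hx n))
    have h3 := dist_triangle_right (T y) y (T (x n))
    linarith
  have hlim : Filter.Tendsto (fun n : ℕ => 2 * (p * δ / (1 - q) + δ) * q ^ n) Filter.atTop
      (nhds 0) := by
    simpa using (tendsto_pow_atTop_nhds_zero_of_lt_one hq0.le hq1).const_mul
      (2 * (p * δ / (1 - q) + δ))
  exact dist_le_zero.1 (ge_of_tendsto' hlim hbound)
end
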